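/- Let K be a division ring and let A, B, C, D ∈ K be pairwise distinct. Then c_r(A, C; D, B) = (1 − c_r(A, B; C, D))⁻¹, where 1 is the multiplicative identity of K. -/

import Mathlib

def crossRatio {K : Type*} [DivisionRing K] (A B C D : K) : K :=
  ((A - D)⁻¹ * (B - D)) * ((B - C)⁻¹ * (A - C))

/-- The complement to one of a cross-ratio, as a single product. -/
theorem one_sub_crossRatio {K : Type*} [DivisionRing K] (A B C D : K)
    (hAD : A ≠ D) (hBC : B ≠ C) :
    1 - crossRatio A B C D = (A - D)⁻¹ * ((C - D) * ((C - B)⁻¹ * (A - B))) := by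
  have hAD' : A - D ≠ 0 := sub_ne_zero.mpr hAD
  have hBC' : B - C ≠ 0 := sub_ne_zero.mpr hBC
  have hinv : (C - B)⁻¹ = -(B - C)⁻¹ := by rw [← neg_sub B C, inv_neg]
  have hBD : (B - D) * ((B - C)⁻¹ * (A - C)) =
      (A - C) + (C - D) * ((B - C)⁻¹ * (A - C)) := by
    rw [← sub_add_sub_cancel B C D, add_mul, mul_inv_cancel_left₀ hBC']
  have hAB : (B - C)⁻¹ * (A - B) = (B - C)⁻¹ * (A - C) - 1 := by
    rw [← sub_sub_sub_cancel_right A B C, mul_sub, inv_mul_cancel₀ hBC']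
  apply mul_left_cancel₀ hAD'
  rw [mul_inv_cancel_left₀ hAD', crossRatio, mul_sub, mul_one, mul_assoc (A - D)⁻¹,
    mul_inv_cancel_left₀ hAD', hBD, hinv, neg_mul, hAB, mul_neg, mul_sub (C - D), mul_one]
  abel

theorem crossRatio_ACDB {K : Type*} [DivisionRing K]
    (A B C D : K) (hAB : A ≠ B) (hAC : A ≠ C) (hAD : A ≠ D)
    (hBC : B ≠ C) (hBD : B ≠ D) (hCD : C ≠ D) :
    crossRatio A C D B = (1 - crossRatio A B C D)⁻¹ := by
  rw [one_sub_crossRatio A B C D hAD hBC]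
  simp only [crossRatio, mul_inv_rev, inv_inv, mul_assoc]
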